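/- There is a universal constant C such that: in every undirected polymatroidal network, for any multicommodity flow instance with k ≥ 2 source-sink pairs and demands D_1,…,D_k, the minimum sparsity min_{F ⊆ E, D(F)>0} ν(F)/D(F) is at most C·(log k) times the value of the maximum concurrent flow. -/

import Mathlib

open Finset MeasureTheory
open scoped ENNReal Classical

/-- `UWalk ep1 ep2 s t p`: in the undirected graph whose edge `e` has endpoints
`ep1 e` and `ep2 e`, the list of edges `p` forms a walk from `s` to `t`. -/
def UWalk {V E : Type} [DecidableEq V] (ep1 ep2 : E → V) : V → V → List E → Prop
  | s, t, [] => s = t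
  | s, t, e :: p => (ep1 e = s ∨ ep2 e = s) ∧
      UWalk ep1 ep2 (if ep1 e = s then ep2 e else ep1 e) t p

/-- The list of vertices visited by an undirected walk starting at `s`. -/
def uwalkVerts {V E : Type} [DecidableEq V] (ep1 ep2 : E → V) : V → List E → List V
  | s, [] => [s]
  | s, e :: p => s :: uwalkVerts ep1 ep2 (if ep1 e = s then ep2 e else ep1 e) p

/-- A simple undirected path from `s` to `t`. -/
def UIsPath {V E : Type} [DecidableEq V] (ep1 ep2 : E → V) (s t : V) (p : List E) : Prop :=
  UWalk ep1 ep2 s t p ∧ (uwalkVerts ep1 ep2 s p).Nodup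

/-- `F` separates `s` and `t`: they lie in different connected components of `G∖F`. -/
def USep {V E : Type} [DecidableEq V] (ep1 ep2 : E → V) (F : Finset E) (s t : V) : Prop :=
  ¬ ∃ p : List E, UWalk ep1 ep2 s t p ∧ ∀ e ∈ p, e ∉ F

/-- `δ(S)`: the set of edges with exactly one endpoint in `S`. -/
def uvcut {V E : Type} [Fintype E] [DecidableEq V] (ep1 ep2 : E → V) (S : Finset V) :
    Finset E :=
  Finset.univ.filter (fun e => (ep1 e ∈ S ∧ ep2 e ∉ S) ∨ (ep1 e ∉ S ∧ ep2 e ∈ S))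

/-- Shortest-path distance (in `ℝ≥0∞`, `⊤` when unreachable) under edge lengths `len`. -/
noncomputable def udist {V E : Type} [DecidableEq V] (ep1 ep2 : E → V) (len : E → ℝ)
    (u v : V) : ℝ≥0∞ :=
  ⨅ p : { p : List E // UWalk ep1 ep2 u v p }, ENNReal.ofReal ((p.1.map len).sum)

/-- The Lovász extension of `ρ` on the ground set `ground`,
`ρ̂(x) = ∫_0^∞ ρ({e ∈ ground : x e ≥ θ}) dθ` (which agrees with `∫_0^1` when `x ≤ 1`). -/
noncomputable def lovaszExt {E : Type} [Fintype E] (ρ : Finset E → ℝ)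
    (ground : Finset E) (x : E → ℝ) : ℝ :=
  ∫ θ in Set.Ioi (0:ℝ), ρ (ground.filter (fun e => θ ≤ x e))

/-- An undirected polymatroidal network: a finite undirected graph together with,
for each node `v`, a polymatroid `rho v` on the set of edges incident to `v`. -/
structure UPolyNet (V E : Type) [Fintype V] [Fintype E] [DecidableEq V] [DecidableEq E] where
  ep1 : E → V
  ep2 : E → V
  rho : V → Finset E → ℝ
  rho_empty : ∀ v, rho v ∅ = 0
  rho_nonneg : ∀ v A, A ⊆ Finset.univ.filter (fun e => ep1 e = v ∨ ep2 e = v) → 0 ≤ rho v A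
  rho_mono : ∀ v A B, A ⊆ B → B ⊆ Finset.univ.filter (fun e => ep1 e = v ∨ ep2 e = v) →
    rho v A ≤ rho v B
  rho_submod : ∀ v A B, A ⊆ Finset.univ.filter (fun e => ep1 e = v ∨ ep2 e = v) →
    B ⊆ Finset.univ.filter (fun e => ep1 e = v ∨ ep2 e = v) →
    rho v (A ∪ B) + rho v (A ∩ B) ≤ rho v A + rho v B

namespace UPolyNet

variable {V E : Type} [Fintype V] [Fintype E] [DecidableEq V] [DecidableEq E]

/-- The set `δ(v)` of edges incident to `v` (the ground set of `rho v`). -/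
def incE (N : UPolyNet V E) (v : V) : Finset E :=
  Finset.univ.filter (fun e => N.ep1 e = v ∨ N.ep2 e = v)

/-- The cost `ν(F)` of the edge cut `F`: the minimum over valid assignments `g` of
the edges of `F` to their endpoints of `Σ_v ρ_v(g⁻¹(v))`. -/
noncomputable def cutCost (N : UPolyNet V E) (F : Finset E) : ℝ :=
  sInf { c : ℝ | ∃ g : E → V, (∀ e ∈ F, g e = N.ep1 e ∨ g e = N.ep2 e) ∧
    c = ∑ v : V, N.rho v ((N.incE v ∩ F).filter (fun e => g e = v)) }

/-- Total flow on an edge `e`. -/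
noncomputable def edgeFlow (N : UPolyNet V E) {ι : Type} [Fintype ι]
    (f : ι → List E → ℝ) (e : E) : ℝ :=
  ∑ i : ι, ∑ᶠ p ∈ {p : List E | e ∈ p}, f i p

/-- The rate of commodity `i`. -/
noncomputable def rate {ι : Type} (f : ι → List E → ℝ) (i : ι) : ℝ :=
  ∑ᶠ p : List E, f i p

/-- A feasible multicommodity flow for the source-sink pairs `(s i, t i)`. -/
structure IsFlow (N : UPolyNet V E) {ι : Type} [Fintype ι] (s t : ι → V)
    (f : ι → List E → ℝ) : Prop where
  nonneg : ∀ i p, 0 ≤ f i p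
  supp : ∀ i p, f i p ≠ 0 → UIsPath N.ep1 N.ep2 (s i) (t i) p
  fin : ∀ i, (Function.support (f i)).Finite
  cap : ∀ v, ∀ S ⊆ N.incE v, ∑ e ∈ S, N.edgeFlow f e ≤ N.rho v S

/-- `D(F)`: the total demand of the pairs separated by `F`. -/
noncomputable def sepDemand (N : UPolyNet V E) {ι : Type} [Fintype ι]
    (s t : ι → V) (D : ι → ℝ) (F : Finset E) : ℝ :=
  ∑ i : ι, if USep N.ep1 N.ep2 F (s i) (t i) then D i else 0

/-- The value of the maximum throughput multicommodity flow. -/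
noncomputable def maxThroughput (N : UPolyNet V E) {ι : Type} [Fintype ι]
    (s t : ι → V) : ℝ :=
  sSup { r : ℝ | ∃ f : ι → List E → ℝ, N.IsFlow s t f ∧ r = ∑ i : ι, rate f i }

/-- The value of the maximum concurrent multicommodity flow for demands `D`. -/
noncomputable def maxConcurrent (N : UPolyNet V E) {ι : Type} [Fintype ι]
    (s t : ι → V) (D : ι → ℝ) : ℝ :=
  sSup { lam : ℝ | ∃ f : ι → List E → ℝ, N.IsFlow s t f ∧ ∀ i, rate f i = lam * D i }

/-- The vector `d_v`: for an edge `e` incident to `v`, its portion `ℓ(e,v)`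
assigned to `v` by the fractional cut solution with portions `c1` (at `ep1`)
and `c2` (at `ep2`). -/
def dvec (N : UPolyNet V E) (c1 c2 : E → ℝ) (v : V) : E → ℝ :=
  fun e => if N.ep1 e = v then c1 e else c2 e

/-- `ρ̂_v(d_v)`, the contribution of the node `v` to the fractional cut cost. -/
noncomputable def nodeVol (N : UPolyNet V E) (c1 c2 : E → ℝ) (v : V) : ℝ :=
  lovaszExt (N.rho v) (N.incE v) (N.dvec c1 c2 v)

/-- `vol(X) = Σ_{v ∈ X} ρ̂_v(d_v)`. -/
noncomputable def vol (N : UPolyNet V E) (c1 c2 : E → ℝ) (X : Finset V) : ℝ :=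
  ∑ v ∈ X, N.nodeVol c1 c2 v

end UPolyNet

open UPolyNet

section Walks

variable {V E : Type} [DecidableEq V] {ep1 ep2 : E → V}

theorem UWalk.append {u v w : V} {p q : List E} (hp : UWalk ep1 ep2 u v p)
    (hq : UWalk ep1 ep2 v w q) : UWalk ep1 ep2 u w (p ++ q) := by
  induction p generalizing u with
  | nil => rw [UWalk] at hp; subst hp; simpa using hq
  | cons e p ih => exact ⟨hp.1, ih hp.2⟩

theorem UWalk.reverse {u v : V} {p : List E} (hp : UWalk ep1 ep2 u v p) :
    UWalk ep1 ep2 v u p.reverse := by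
  induction p generalizing u with
  | nil => rw [UWalk] at hp; subst hp; simp [UWalk]
  | cons e p ih =>
    rw [List.reverse_cons]
    refine (ih hp.2).append ?_
    have h := hp.1
    simp only [UWalk]
    split_ifs <;> grind

theorem UWalk.single (e : E) : UWalk ep1 ep2 (ep1 e) (ep2 e) [e] := by
  simp [UWalk]

theorem uwalkVerts_length (u : V) (p : List E) :
    (uwalkVerts ep1 ep2 u p).length = p.length + 1 := by
  induction p generalizing u with
  | nil => rfl
  | cons e p ih => simp [uwalkVerts, ih]

/-- The part of a simple path after one of its vertices is a simple path. -/
theorem UIsPath.exists_suffix {u v x : V} {p : List E} (hp : UIsPath ep1 ep2 u v p)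
    (hx : x ∈ uwalkVerts ep1 ep2 u p) : ∃ q, q <:+ p ∧ UIsPath ep1 ep2 x v q := by
  induction p generalizing u with
  | nil =>
    simp only [uwalkVerts, List.mem_singleton] at hx
    exact ⟨[], List.suffix_refl _, hx ▸ hp⟩
  | cons e p ih =>
    obtain ⟨hw, hn⟩ := hp
    simp only [uwalkVerts, List.mem_cons] at hx
    rcases hx with rfl | hx
    · exact ⟨_, List.suffix_refl _, hw, hn⟩
    · obtain ⟨q, hq, hq'⟩ := ih ⟨hw.2, (List.nodup_cons.1 hn).2⟩ hx
      exact ⟨q, hq.trans (List.suffix_cons _ _), hq'⟩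

/-- Every walk contains a simple path with the same ends. -/
theorem UWalk.exists_path {u v : V} {p : List E} (hp : UWalk ep1 ep2 u v p) :
    ∃ q, q.Sublist p ∧ UIsPath ep1 ep2 u v q := by
  induction p generalizing u with
  | nil => exact ⟨[], List.Sublist.refl _, hp, by simp [uwalkVerts]⟩
  | cons e p ih =>
    obtain ⟨q, hq, hq'⟩ := ih hp.2
    by_cases hu : u ∈ uwalkVerts ep1 ep2 (if ep1 e = u then ep2 e else ep1 e) q
    · obtain ⟨r, hr, hr'⟩ := hq'.exists_suffix hu
      exact ⟨r, (hr.sublist.trans hq).trans (List.sublist_cons_self _ _), hr'⟩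
    · exact ⟨e :: q, hq.cons_cons e, ⟨hp.1, hq'.1⟩, List.nodup_cons.2 ⟨hu, hq'.2⟩⟩

theorem UIsPath.length_le [Fintype V] {u v : V} {p : List E} (hp : UIsPath ep1 ep2 u v p) :
    p.length ≤ Fintype.card V := by
  have := hp.2.length_le_card
  rw [uwalkVerts_length] at this
  omega

theorem finite_setOf_uIsPath [Fintype V] [Finite E] (u v : V) :
    {p | UIsPath ep1 ep2 u v p}.Finite :=
  (List.finite_length_le E (Fintype.card V)).subset fun _ hp => hp.length_le

theorem List.Sublist.sum_map_le {len : E → ℝ} (hlen : ∀ e, 0 ≤ len e) {p q : List E}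
    (h : q.Sublist p) : (q.map len).sum ≤ (p.map len).sum := by
  refine (h.map len).sum_le_sum fun x hx => ?_
  obtain ⟨e, -, rfl⟩ := List.mem_map.1 hx
  exact hlen e

/-- A shortest walk may be taken to be a simple path. -/
theorem exists_shortest_path [Fintype V] [Finite E] {len : E → ℝ} (hlen : ∀ e, 0 ≤ len e)
    {u v : V} (h : ∃ p, UWalk ep1 ep2 u v p) :
    ∃ p, UIsPath ep1 ep2 u v p ∧
      ∀ q, UWalk ep1 ep2 u v q → (p.map len).sum ≤ (q.map len).sum := by
  obtain ⟨p₀, hp₀⟩ := h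
  obtain ⟨q₀, -, hq₀⟩ := hp₀.exists_path
  obtain ⟨p, hp, hmin⟩ := Set.exists_min_image {p | UIsPath ep1 ep2 u v p}
    (fun p => (p.map len).sum) (finite_setOf_uIsPath u v) ⟨q₀, hq₀⟩
  refine ⟨p, hp, fun q hq => ?_⟩
  obtain ⟨r, hr, hr'⟩ := hq.exists_path
  exact (hmin r hr').trans (hr.sum_map_le hlen)

/-- The shortest-path distance, truncated at a large constant, is a finite pseudometric. -/
theorem exists_path_pseudometric [Fintype V] [Fintype E] (ep1 ep2 : E → V) {len : E → ℝ}
    (hlen : ∀ e, 0 ≤ len e) :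
    ∃ d : V → V → ℝ, (∀ u, d u u = 0) ∧ (∀ u v, 0 ≤ d u v) ∧ (∀ u v, d u v = d v u) ∧
      (∀ u v w, d u w ≤ d u v + d v w) ∧ (∀ e, d (ep1 e) (ep2 e) ≤ len e) ∧
      ∀ u v, (∃ p, UWalk ep1 ep2 u v p) →
        ∃ p, UIsPath ep1 ep2 u v p ∧ (p.map len).sum ≤ d u v := by
  set M : ℝ := Fintype.card V • ∑ e, len e with hM
  have hM0 : 0 ≤ M := nsmul_nonneg (Finset.sum_nonneg fun e _ => hlen e) _
  have hpath : ∀ u v p, UIsPath ep1 ep2 u v p → (p.map len).sum ≤ M := by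
    intro u v p hp
    have h1 : (p.map len).sum ≤ (p.map len).length • ∑ e, len e := by
      refine List.sum_le_card_nsmul _ _ fun x hx => ?_
      obtain ⟨e, -, rfl⟩ := List.mem_map.1 hx
      exact Finset.single_le_sum (fun e _ => hlen e) (Finset.mem_univ e)
    refine h1.trans ?_
    rw [List.length_map]
    exact nsmul_le_nsmul_left (Finset.sum_nonneg fun e _ => hlen e) hp.length_le
  have hnn : ∀ p : List E, 0 ≤ (p.map len).sum := fun p => by
    simpa using (List.nil_sublist p).sum_map_le hlen
  let L : V → V → Set ℝ := fun u v =>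
    insert M {r | ∃ p, UWalk ep1 ep2 u v p ∧ r = (p.map len).sum}
  have hex : ∀ u v, ∃ r, IsLeast (L u v) r := by
    intro u v
    by_cases h : ∃ p, UWalk ep1 ep2 u v p
    · obtain ⟨p, hp, hmin⟩ := exists_shortest_path hlen h
      refine ⟨(p.map len).sum, Or.inr ⟨p, hp.1, rfl⟩, ?_⟩
      rintro r (rfl | ⟨q, hq, rfl⟩)
      · exact hpath _ _ _ hp
      · exact hmin q hq
    · refine ⟨M, Or.inl rfl, ?_⟩
      rintro r (rfl | ⟨q, hq, rfl⟩)
      · exact le_rfl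
      · exact absurd ⟨q, hq⟩ h
  choose d hd using hex
  have hd0 : ∀ u v, 0 ≤ d u v := by
    intro u v
    rcases (hd u v).1 with h | ⟨p, -, h⟩
    · rw [h]; exact hM0
    · rw [h]; exact hnn p
  have hsymm : ∀ u v, d u v ≤ d v u := by
    intro u v
    rcases (hd v u).1 with h | ⟨p, hp, h⟩
    · rw [h]; exact (hd u v).2 (Or.inl rfl)
    · exact (hd u v).2 (Or.inr ⟨p.reverse, hp.reverse, by rw [h]; simp⟩)
  refine ⟨d, fun u => le_antisymm ?_ (hd0 u u), hd0, fun u v => le_antisymm (hsymm u v) (hsymm v u),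
    ?_, ?_, ?_⟩
  · exact (hd u u).2 (Or.inr ⟨[], rfl, by simp⟩)
  · intro u v w
    rcases (hd u v).1 with h | ⟨p, hp, h⟩
    · have := (hd u w).2 (Or.inl rfl)
      linarith [hd0 v w]
    rcases (hd v w).1 with h' | ⟨q, hq, h'⟩
    · have := (hd u w).2 (Or.inl rfl)
      linarith [hd0 u v]
    · rw [h, h']
      exact (hd u w).2 (Or.inr ⟨p ++ q, hp.append hq, by simp⟩)
  · intro e
    exact (hd _ _).2 (Or.inr ⟨[e], UWalk.single e, by simp⟩)
  · intro u v h
    obtain ⟨p, hp, hmin⟩ := exists_shortest_path hlen h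
    refine ⟨p, hp, ?_⟩
    rcases (hd u v).1 with h | ⟨q, hq, h⟩
    · rw [h]; exact hpath _ _ _ hp
    · rw [h]; exact hmin q hq

end Walks

section Greedy

/-- Edmonds' greedy algorithm: a vector of a polymatroid that is tight on all upper level sets
of `c`. -/
theorem exists_greedy_vector {E : Type} [DecidableEq E] (ρ : Finset E → ℝ) (ground : Finset E)
    (h_empty : ρ ∅ = 0)
    (h_submod : ∀ A B, A ⊆ ground → B ⊆ ground → ρ (A ∪ B) + ρ (A ∩ B) ≤ ρ A + ρ B)
    (c : E → ℝ) :
    ∃ x : E → ℝ, (∀ S ⊆ ground, ∑ e ∈ S, x e ≤ ρ S) ∧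
      ∀ θ : ℝ, ∑ e ∈ ground with θ ≤ c e, x e = ρ {e ∈ ground | θ ≤ c e} := by
  induction ground using Finset.induction_on_min_value c with
  | empty => exact ⟨0, fun S hS => by simp [Finset.subset_empty.1 hS, h_empty], by simp [h_empty]⟩
  | insert a s has hmin ih =>
    obtain ⟨x, hx, hx'⟩ := ih fun A B hA hB =>
      h_submod A B (hA.trans (subset_insert _ _)) (hB.trans (subset_insert _ _))
    set y := Function.update x a (ρ (insert a s) - ρ s) with hy
    have hya : y a = ρ (insert a s) - ρ s := by simp [hy]
    have hyS : ∀ S : Finset E, a ∉ S → ∑ e ∈ S, y e = ∑ e ∈ S, x e := fun S hS =>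
      Finset.sum_congr rfl fun e he => by
        rw [hy, Function.update_of_ne (ne_of_mem_of_not_mem he hS)]
    refine ⟨y, fun S hS => ?_, fun θ => ?_⟩
    · by_cases haS : a ∈ S
      · have hsub : S.erase a ⊆ s := by
          intro e he
          exact (mem_insert.1 (hS (mem_of_mem_erase he))).resolve_left (ne_of_mem_erase he)
        have h1 := h_submod S s hS (subset_insert _ _)
        have hU : S ∪ s = insert a s := by
          ext e; have := @hS e; grind
        have hI : S ∩ s = S.erase a := by
          ext e; have := @hS e; grind
        rw [hU, hI] at h1
        rw [← Finset.add_sum_erase _ _ haS, hya, hyS _ (notMem_erase a S)]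
        linarith [hx _ hsub]
      · rw [hyS S haS]
        exact hx S ((subset_insert_iff_of_notMem haS).1 hS)
    · by_cases hθ : θ ≤ c a
      · have h1 : {e ∈ insert a s | θ ≤ c e} = insert a s :=
          filter_true_of_mem fun e he => by
            rcases mem_insert.1 he with rfl | he
            · exact hθ
            · exact hθ.trans (hmin e he)
        have h2 : {e ∈ s | θ ≤ c e} = s :=
          filter_true_of_mem fun e he => hθ.trans (hmin e he)
        have h3 := hx' θ
        rw [h2] at h3
        rw [h1, sum_insert has, hya, hyS s has, h3]
        ring
      · rw [filter_insert, if_neg hθ, hyS _ (by simp [has]), hx' θ]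

end Greedy

section IntegralComparison

/-- Integrating a pointwise inequality between step functions. -/
theorem sum_length_le_of_step_le {I J : Type} (s : Finset I) (t : Finset J) (a l u : I → ℝ)
    (b l' u' : J → ℝ) (hlu : ∀ i, l i ≤ u i) (hlu' : ∀ j, l' j ≤ u' j)
    (h : ∀ θ : ℝ, ∑ i ∈ s, a i * (Set.Ico (l i) (u i)).indicator 1 θ ≤
      ∑ j ∈ t, b j * (Set.Icc (l' j) (u' j)).indicator 1 θ) :
    ∑ i ∈ s, a i * (u i - l i) ≤ ∑ j ∈ t, b j * (u' j - l' j) := by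
  have hi : ∀ i, Integrable (fun θ => a i * (Set.Ico (l i) (u i)).indicator (1 : ℝ → ℝ) θ) :=
    fun i => ((integrable_indicator_iff measurableSet_Ico).2
      (integrableOn_const (by simp))).const_mul _
  have hj : ∀ j, Integrable (fun θ => b j * (Set.Icc (l' j) (u' j)).indicator (1 : ℝ → ℝ) θ) :=
    fun j => ((integrable_indicator_iff measurableSet_Icc).2
      (integrableOn_const (by simp))).const_mul _
  have key := integral_mono (integrable_finsetSum s fun i _ => hi i)
    (integrable_finsetSum t fun j _ => hj j) h
  rw [integral_finsetSum _ fun i _ => hi i, integral_finsetSum _ fun j _ => hj j] at key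
  simpa [integral_const_mul, integral_indicator_one, measurableSet_Ico, measurableSet_Icc,
    Real.volume_real_Ico_of_le, Real.volume_real_Icc_of_le, hlu, hlu'] using key

end IntegralComparison

section Bourgain

variable {V : Type}

/-- The distance to the set `A` (and `0` if `A` is empty). -/
noncomputable def distToSet (d : V → V → ℝ) (A : Finset V) (v : V) : ℝ :=
  if h : A.Nonempty then A.inf' h (d v) else 0

theorem distToSet_sub_le {d : V → V → ℝ} (hnn : ∀ u v, 0 ≤ d u v)
    (htri : ∀ u v w, d u w ≤ d u v + d v w) (A : Finset V) (u v : V) :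
    distToSet d A u - distToSet d A v ≤ d u v := by
  unfold distToSet
  split_ifs with h
  · obtain ⟨a, ha, hav⟩ := A.exists_mem_eq_inf' h (d v)
    rw [hav]
    linarith [Finset.inf'_le (d u) ha, htri u v a]
  · simpa using hnn u v

theorem abs_distToSet_sub_le {d : V → V → ℝ} (hnn : ∀ u v, 0 ≤ d u v)
    (hsymm : ∀ u v, d u v = d v u) (htri : ∀ u v w, d u w ≤ d u v + d v w) (A : Finset V)
    (u v : V) : |distToSet d A u - distToSet d A v| ≤ d u v :=
  abs_sub_le_iff.2 ⟨distToSet_sub_le hnn htri A u v,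
    hsymm u v ▸ distToSet_sub_le hnn htri A v u⟩

/-- If `A` hits the ball of radius `r` around `x` and misses the one around `y`, then `r`
lies between the distances of `x` and `y` to `A`. -/
theorem distToSet_le_and_lt {d : V → V → ℝ} {T A : Finset V} (hA : A ⊆ T) {x y : V} {r : ℝ}
    (hx : ¬ Disjoint A {a ∈ T | d x a ≤ r}) (hy : Disjoint A {a ∈ T | d y a ≤ r}) :
    distToSet d A x ≤ r ∧ r < distToSet d A y := by
  obtain ⟨a, ha, hax⟩ := Finset.not_disjoint_iff.1 hx
  have hne : A.Nonempty := ⟨a, ha⟩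
  unfold distToSet
  rw [dif_pos hne, dif_pos hne]
  refine ⟨(Finset.inf'_le _ ha).trans (mem_filter.1 hax).2, (Finset.lt_inf'_iff hne).2 ?_⟩
  intro b hb
  by_contra! h
  exact Finset.disjoint_left.1 hy hb (mem_filter.2 ⟨hA hb, h⟩)

variable [DecidableEq V]

/-- The probability of obtaining `A` when each element of `T` is kept independently with
probability `p`. -/
noncomputable def randomSubsetWeight (T : Finset V) (p : ℝ) (A : Finset V) : ℝ :=
  p ^ #A * (1 - p) ^ #(T \ A)

theorem randomSubsetWeight_nonneg (T : Finset V) {p : ℝ} (hp : 0 ≤ p) (hp1 : p ≤ 1)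
    (A : Finset V) : 0 ≤ randomSubsetWeight T p A :=
  mul_nonneg (pow_nonneg hp _) (pow_nonneg (sub_nonneg.2 hp1) _)

/-- The probability that a random subset of `T` misses `B`. -/
theorem sum_randomSubsetWeight_disjoint {T B : Finset V} (hB : B ⊆ T) (p : ℝ) :
    ∑ A ∈ T.powerset, (if Disjoint A B then randomSubsetWeight T p A else 0) =
      (1 - p) ^ #B := by
  have h := Finset.prod_add (fun a => if a ∈ B then 0 else p) (fun _ => 1 - p) T
  have h1 : ∏ a ∈ T, ((if a ∈ B then 0 else p) + (1 - p)) = (1 - p) ^ #B := by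
    have : ∀ a, (if a ∈ B then 0 else p) + (1 - p) = if a ∈ B then 1 - p else 1 := by
      intro a; split_ifs <;> ring
    simp_rw [this]
    rw [← Finset.prod_filter, Finset.filter_mem_eq_inter, Finset.inter_eq_right.2 hB,
      Finset.prod_const]
  rw [← h1, h]
  refine Finset.sum_congr rfl fun A _ => ?_
  rw [Finset.prod_const, randomSubsetWeight]
  split_ifs with hd
  · rw [Finset.prod_congr rfl fun a ha => if_neg (Finset.disjoint_left.1 hd ha),
      Finset.prod_const]
  · obtain ⟨a, ha, hb⟩ := Finset.not_disjoint_iff.1 hd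
    rw [Finset.prod_eq_zero (f := fun a => if a ∈ B then (0 : ℝ) else p) ha (if_pos hb), zero_mul]

theorem sum_randomSubsetWeight (T : Finset V) (p : ℝ) :
    ∑ A ∈ T.powerset, randomSubsetWeight T p A = 1 := by
  simpa using sum_randomSubsetWeight_disjoint (Finset.empty_subset T) p

/-- The probability that a random subset of `T` hits `X` and misses `Y`. -/
theorem sum_randomSubsetWeight_hit {T X Y : Finset V} (hX : X ⊆ T) (hY : Y ⊆ T)
    (hXY : Disjoint X Y) (p : ℝ) :
    ∑ A ∈ T.powerset,
      (if ¬ Disjoint A X ∧ Disjoint A Y then randomSubsetWeight T p A else 0) =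
      (1 - p) ^ #Y * (1 - (1 - p) ^ #X) := by
  have h := sum_randomSubsetWeight_disjoint (Finset.union_subset hX hY) p
  rw [Finset.card_union_of_disjoint hXY] at h
  rw [mul_sub, mul_one, ← pow_add, add_comm #Y, ← h, ← sum_randomSubsetWeight_disjoint hY p,
    ← Finset.sum_sub_distrib]
  refine Finset.sum_congr rfl fun A _ => ?_
  by_cases h1 : Disjoint A X <;> by_cases h2 : Disjoint A Y <;>
    simp [h1, h2, Finset.disjoint_union_right]

theorem one_twelfth_le_hit_probability {m y : ℕ} (hm : m ≠ 0) (hy : y ≤ m) :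
    (1 / 12 : ℝ) ≤ (1 - (1 / 2) ^ (Nat.log 2 m + 1)) ^ y *
      (1 - (1 - (1 / 2) ^ (Nat.log 2 m + 1)) ^ m) := by
  set i := Nat.log 2 m
  have hlo : 2 ^ i ≤ m := Nat.pow_log_le_self 2 hm
  have hhi : m ≤ 2 ^ i * 2 := (Nat.lt_pow_succ_log_self one_lt_two m).le
  set p : ℝ := (1 / 2) ^ (i + 1) with hp
  have hp0 : 0 < p := by positivity
  have hp1 : p ≤ 1 := pow_le_one₀ (by norm_num) (by norm_num)
  have hpi : (2 ^ i : ℕ) * p = 1 / 2 := by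
    push_cast
    rw [hp, pow_succ, ← mul_assoc, ← mul_pow]
    norm_num
  have hq0 : 0 ≤ 1 - p := sub_nonneg.2 hp1
  have hq1 : 1 - p ≤ 1 := by linarith
  have hlow : 1 / 2 ≤ (1 - p) ^ (2 ^ i) := by
    have := one_add_mul_le_pow (a := -p) (by linarith) (2 ^ i)
    rw [← sub_eq_add_neg] at this
    linarith
  have hupp : (1 - p) ^ (2 ^ i) ≤ 2 / 3 := by
    have h1 : (1 - p) ^ (2 ^ i) ≤ Real.exp (-(1 / 2)) := by
      calc (1 - p) ^ (2 ^ i) ≤ Real.exp (-p) ^ (2 ^ i) :=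
            pow_le_pow_left₀ hq0 (Real.one_sub_le_exp_neg p) _
        _ = Real.exp (-(1 / 2)) := by
            rw [← Real.exp_nat_mul, mul_neg, hpi]
    have h2 : (3 / 2 : ℝ) ≤ Real.exp (1 / 2) := by
      have := Real.add_one_le_exp (1 / 2 : ℝ)
      linarith
    rw [Real.exp_neg] at h1
    refine h1.trans ?_
    rw [inv_le_comm₀ (by positivity) (by norm_num)]
    linarith
  have h1 : 1 / 4 ≤ (1 - p) ^ y := by
    have : (1 - p) ^ (2 ^ i * 2) ≤ (1 - p) ^ y :=
      pow_le_pow_of_le_one hq0 hq1 (hy.trans hhi)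
    rw [pow_mul] at this
    nlinarith
  have h2 : (1 - p) ^ m ≤ 2 / 3 := (pow_le_pow_of_le_one hq0 hq1 hlo).trans hupp
  nlinarith

/-- A Fréchet coordinate at a suitable scale separates two disjoint balls with constant
probability. -/
theorem one_twelfth_le_sum_separate {T X Y : Finset V} (hX : X ⊆ T) (hY : Y ⊆ T)
    (hXY : Disjoint X Y) (hX0 : X.Nonempty) (hcard : #Y ≤ #X) :
    (1 / 12 : ℝ) ≤ ∑ jA ∈ range (Nat.log 2 #T + 1) ×ˢ T.powerset,
      (if ¬ Disjoint jA.2 X ∧ Disjoint jA.2 Y then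
        randomSubsetWeight T ((1 / 2) ^ (jA.1 + 1)) jA.2 else 0) := by
  have hj : Nat.log 2 #X ∈ range (Nat.log 2 #T + 1) :=
    mem_range.2 (Nat.lt_succ_of_le (Nat.log_mono_right (card_le_card hX)))
  rw [sum_product]
  refine le_trans ?_ (single_le_sum (fun j _ => sum_nonneg fun A _ => ?_) hj)
  · dsimp only
    rw [sum_randomSubsetWeight_hit hX hY hXY]
    exact one_twelfth_le_hit_probability hX0.card_pos.ne' hcard
  · split_ifs
    · exact randomSubsetWeight_nonneg T (by positivity)
        (pow_le_one₀ (by norm_num) (by norm_num)) _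
    · exact le_rfl

/-- Bourgain's theorem, in averaged form: the distances to random subsets at logarithmically
many scales preserve the distance between any two points of `T` up to a constant in total. -/
theorem dist_le_sum_abs_distToSet {d : V → V → ℝ} (hself : ∀ u, d u u = 0)
    (hnn : ∀ u v, 0 ≤ d u v) (hsymm : ∀ u v, d u v = d v u)
    (htri : ∀ u v w, d u w ≤ d u v + d v w) {T : Finset V} {x y : V} (hx : x ∈ T)
    (hy : y ∈ T) :
    d x y / 24 ≤ ∑ jA ∈ range (Nat.log 2 #T + 1) ×ˢ T.powerset,
      randomSubsetWeight T ((1 / 2) ^ (jA.1 + 1)) jA.2 *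
        |distToSet d jA.2 x - distToSet d jA.2 y| := by
  have hw : ∀ jA : ℕ × Finset V, 0 ≤ randomSubsetWeight T ((1 / 2) ^ (jA.1 + 1)) jA.2 :=
    fun jA => randomSubsetWeight_nonneg T (by positivity)
      (pow_le_one₀ (by norm_num) (by norm_num)) _
  have key := sum_length_le_of_step_le ({()} : Finset Unit)
    (range (Nat.log 2 #T + 1) ×ˢ T.powerset) (fun _ => 1 / 12) (fun _ => 0)
    (fun _ => d x y / 2)
    (fun jA => randomSubsetWeight T ((1 / 2) ^ (jA.1 + 1)) jA.2)
    (fun jA => min (distToSet d jA.2 x) (distToSet d jA.2 y))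
    (fun jA => max (distToSet d jA.2 x) (distToSet d jA.2 y))
    (fun _ => by linarith [hnn x y]) (fun _ => min_le_max) ?_
  · simp only [sum_singleton, max_sub_min_eq_abs'] at key
    linarith
  intro r
  rw [sum_singleton]
  by_cases hr : r ∈ Set.Ico 0 (d x y / 2)
  swap
  · rw [Set.indicator_of_notMem hr, mul_zero]
    exact sum_nonneg fun jA _ =>
      mul_nonneg (hw jA) (Set.indicator_nonneg (fun _ _ => zero_le_one) _)
  rw [Set.indicator_of_mem hr, Pi.one_apply, mul_one]
  have hdisj : Disjoint ({a ∈ T | d x a ≤ r}) ({a ∈ T | d y a ≤ r}) := by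
    refine Finset.disjoint_left.2 fun a ha ha' => ?_
    have := htri x a y
    rw [hsymm a y] at this
    linarith [(mem_filter.1 ha).2, (mem_filter.1 ha').2, hr.2]
  have hxX : x ∈ ({a ∈ T | d x a ≤ r}) := mem_filter.2 ⟨hx, (hself x).trans_le hr.1⟩
  have hyY : y ∈ ({a ∈ T | d y a ≤ r}) := mem_filter.2 ⟨hy, (hself y).trans_le hr.1⟩
  rcases le_total #({a ∈ T | d y a ≤ r}) #({a ∈ T | d x a ≤ r}) with hc | hc
  · refine (one_twelfth_le_sum_separate (filter_subset _ _) (filter_subset _ _) hdisj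
      ⟨x, hxX⟩ hc).trans (sum_le_sum fun jA hjA => ?_)
    have hA := mem_powerset.1 (mem_product.1 hjA).2
    split_ifs with h
    · obtain ⟨h1, h2⟩ := distToSet_le_and_lt hA h.1 h.2
      rw [Set.indicator_of_mem (Set.mem_Icc.2 ⟨min_le_of_left_le h1, le_max_of_le_right h2.le⟩)]
      simp
    · exact mul_nonneg (hw jA) (Set.indicator_nonneg (fun _ _ => zero_le_one) _)
  · refine (one_twelfth_le_sum_separate (filter_subset _ _) (filter_subset _ _) hdisj.symm
      ⟨y, hyY⟩ hc).trans (sum_le_sum fun jA hjA => ?_)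
    have hA := mem_powerset.1 (mem_product.1 hjA).2
    split_ifs with h
    · obtain ⟨h1, h2⟩ := distToSet_le_and_lt hA h.1 h.2
      rw [Set.indicator_of_mem (Set.mem_Icc.2 ⟨min_le_of_right_le h1, le_max_of_le_left h2.le⟩)]
      simp
    · exact mul_nonneg (hw jA) (Set.indicator_nonneg (fun _ _ => zero_le_one) _)

end Bourgain

namespace UPolyNet

section Sweep

variable {V E : Type} [Fintype V] [Fintype E] [DecidableEq V] [DecidableEq E]
  (N : UPolyNet V E)

theorem cutCost_bounds (F : Finset E) :
    0 ∈ lowerBounds { c : ℝ | ∃ g : E → V, (∀ e ∈ F, g e = N.ep1 e ∨ g e = N.ep2 e) ∧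
      c = ∑ v : V, N.rho v ((N.incE v ∩ F).filter (fun e => g e = v)) } := by
  rintro _ ⟨g, -, rfl⟩
  exact sum_nonneg fun v _ =>
    N.rho_nonneg v _ ((filter_subset _ _).trans inter_subset_left)

theorem cutCost_nonneg (F : Finset E) : 0 ≤ N.cutCost F :=
  Real.sInf_nonneg fun _ hc => N.cutCost_bounds F hc

theorem cutCost_le {F : Finset E} {g : E → V}
    (hg : ∀ e ∈ F, g e = N.ep1 e ∨ g e = N.ep2 e) :
    N.cutCost F ≤ ∑ v : V, N.rho v ((N.incE v ∩ F).filter (fun e => g e = v)) :=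
  csInf_le ⟨0, N.cutCost_bounds F⟩ ⟨g, hg, rfl⟩

theorem cutCost_empty : N.cutCost ∅ = 0 := by
  refine le_antisymm ?_ (N.cutCost_nonneg ∅)
  simpa [N.rho_empty] using N.cutCost_le (F := ∅) (g := N.ep1) (by simp)

/-- The edges crossing the level `θ` of the function `g`. -/
noncomputable def levelCut (g : V → ℝ) (θ : ℝ) : Finset E :=
  {e | ¬ (g (N.ep1 e) ≤ θ ↔ g (N.ep2 e) ≤ θ)}

theorem uSep_levelCut {g : V → ℝ} {θ : ℝ} {u v : V} (h : ¬ (g u ≤ θ ↔ g v ≤ θ)) :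
    USep N.ep1 N.ep2 (N.levelCut g θ) u v := by
  rintro ⟨p, hp, hF⟩
  refine h ?_
  clear h
  induction p generalizing u with
  | nil => rw [UWalk] at hp; rw [hp]
  | cons e p ih =>
    have he : g (N.ep1 e) ≤ θ ↔ g (N.ep2 e) ≤ θ := by
      simpa [levelCut] using hF e List.mem_cons_self
    refine Iff.trans ?_ (ih hp.2 fun e he => hF e (List.mem_cons_of_mem _ he))
    rcases hp.1 with h | h
    · rw [if_pos h, ← he, h]
    · split_ifs with h'
      · rw [← he, h']
      · rw [he, h]

/-- The cost of a level cut is controlled by the portions of edge lengths reaching the level. -/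
theorem cutCost_levelCut_le {c : V → E → ℝ} {g : V → ℝ}
    (hg : ∀ e, |g (N.ep1 e) - g (N.ep2 e)| ≤ c (N.ep1 e) e + c (N.ep2 e) e) (θ : ℝ) :
    N.cutCost (N.levelCut g θ) ≤
      ∑ v, N.rho v {e ∈ N.incE v | |θ - g v| ≤ c v e} := by
  refine (N.cutCost_le (g := fun e =>
    if |θ - g (N.ep1 e)| ≤ c (N.ep1 e) e then N.ep1 e else N.ep2 e) ?_).trans
    (sum_le_sum fun v _ => N.rho_mono v _ _ ?_ (filter_subset _ _))
  · intro e _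
    split_ifs <;> simp
  · intro e he
    simp only [mem_filter, mem_inter, levelCut, mem_univ, true_and] at he ⊢
    obtain ⟨⟨hinc, hcross⟩, hv⟩ := he
    refine ⟨hinc, ?_⟩
    split_ifs at hv with h
    · rwa [hv] at h
    · rw [← hv]
      have := abs_le.1 (hg e)
      rw [abs_le, not_and_or, not_le, not_le] at h
      rw [abs_le]
      by_cases h1 : g (N.ep1 e) ≤ θ <;> by_cases h2 : g (N.ep2 e) ≤ θ <;>
        simp only [h1, h2, not_true_eq_false] at hcross <;>
        push Not at * <;> rcases h with h | h <;> constructor <;> linarith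

/-- Line embeddings yield sparse cuts: averaging over the level cuts of `g`. -/
theorem sum_demand_mul_abs_sub_le {ι : Type} [Fintype ι] {s t : ι → V} {D : ι → ℝ}
    (hD : ∀ i, 0 ≤ D i) {β : ℝ} (hβ0 : 0 ≤ β)
    (hβ : ∀ F, β * N.sepDemand s t D F ≤ N.cutCost F)
    {c x : V → E → ℝ} (hc : ∀ v e, 0 ≤ c v e)
    (hx : ∀ v, ∀ θ : ℝ,
      ∑ e ∈ N.incE v with θ ≤ c v e, x v e = N.rho v {e ∈ N.incE v | θ ≤ c v e})
    {g : V → ℝ} (hg : ∀ e, |g (N.ep1 e) - g (N.ep2 e)| ≤ c (N.ep1 e) e + c (N.ep2 e) e) :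
    β * ∑ i, D i * |g (s i) - g (t i)| ≤ 2 * ∑ v, ∑ e ∈ N.incE v, x v e * c v e := by
  have key := sum_length_le_of_step_le (univ : Finset ι) (univ.sigma N.incE)
    (fun i => β * D i) (fun i => min (g (s i)) (g (t i))) (fun i => max (g (s i)) (g (t i)))
    (fun j => x j.1 j.2) (fun j => g j.1 - c j.1 j.2) (fun j => g j.1 + c j.1 j.2)
    (fun i => min_le_max) (fun j => by linarith [hc j.1 j.2]) ?_
  · simp only [max_sub_min_eq_abs', sum_sigma, mul_assoc, ← mul_sum] at key
    refine key.trans_eq ?_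
    simp_rw [mul_sum]
    exact sum_congr rfl fun v _ => sum_congr rfl fun e _ => by ring
  intro θ
  calc ∑ i, β * D i * (Set.Ico (min (g (s i)) (g (t i))) (max (g (s i)) (g (t i)))).indicator 1 θ
      ≤ β * N.sepDemand s t D (N.levelCut g θ) := by
        rw [sepDemand, mul_sum]
        refine sum_le_sum fun i _ => ?_
        rw [mul_assoc]
        refine mul_le_mul_of_nonneg_left ?_ hβ0
        by_cases h : θ ∈ Set.Ico (min (g (s i)) (g (t i))) (max (g (s i)) (g (t i)))
        · rw [Set.indicator_of_mem h, if_pos]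
          · simp
          · refine N.uSep_levelCut fun h' => ?_
            rw [Set.mem_Ico, min_le_iff, lt_max_iff] at h
            grind
        · rw [Set.indicator_of_notMem h, mul_zero]
          split_ifs
          exacts [hD i, le_rfl]
    _ ≤ _ := hβ _
    _ ≤ _ := N.cutCost_levelCut_le hg θ
    _ = _ := by
        rw [sum_sigma]
        refine sum_congr rfl fun v _ => ?_
        rw [← hx v, sum_filter]
        refine sum_congr rfl fun e _ => ?_
        have : |θ - g v| ≤ c v e ↔ θ ∈ Set.Icc (g v - c v e) (g v + c v e) := by
          rw [abs_le, Set.mem_Icc]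
          constructor <;> rintro ⟨h1, h2⟩ <;> constructor <;> linarith
        simp [Set.indicator_apply, this]

end Sweep

end UPolyNet

section PathCombination

variable {Ω P : Type} [Fintype Ω]

theorem finsum_sum_ite_eq [DecidableEq P] (a : Ω → ℝ) (w : Ω → P) :
    ∑ᶠ p, ∑ ω, (if w ω = p then a ω else 0) = ∑ ω, a ω := by
  rw [finsum_eq_sum_of_support_subset (s := univ.image w), sum_comm]
  · exact sum_congr rfl fun ω _ => by simp
  · intro p hp
    obtain ⟨ω, -, hω⟩ := exists_ne_zero_of_sum_ne_zero hp
    simp only [ne_eq, ite_eq_right_iff, not_forall] at hω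
    simpa using ⟨ω, hω.1⟩

theorem finsum_mem_sum_ite_eq [DecidableEq P] (S : Set P) [DecidablePred (· ∈ S)] (a : Ω → ℝ) (w : Ω → P) :
    ∑ᶠ p ∈ S, ∑ ω, (if w ω = p then a ω else 0) = ∑ ω, if w ω ∈ S then a ω else 0 := by
  rw [finsum_mem_def, ← finsum_sum_ite_eq _ w]
  refine finsum_congr fun p => ?_
  by_cases hp : p ∈ S
  · rw [Set.indicator_of_mem hp]
    exact sum_congr rfl fun ω _ => by split_ifs <;> simp_all
  · rw [Set.indicator_of_notMem hp]
    exact (sum_eq_zero fun ω _ => by split_ifs <;> simp_all).symm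

end PathCombination

namespace UPolyNet

section Duality

variable {V E : Type} [Fintype V] [Fintype E] [DecidableEq V] [DecidableEq E]
  (N : UPolyNet V E) {ι : Type} [Fintype ι]

/-- A convex combination of routings along single paths, scaled by `lam`, is a flow of rates
`lam * D` as soon as it respects the capacities. -/
theorem exists_isFlow_of_combination {s t : ι → V} {D : ι → ℝ} (hD : ∀ i, 0 ≤ D i) {lam : ℝ}
    (hlam : 0 ≤ lam) {Ω : Type} [Fintype Ω] {w : Ω → ι → List E}
    (hw : ∀ ω i, 0 < D i → UIsPath N.ep1 N.ep2 (s i) (t i) (w ω i)) {μ : Ω → ℝ}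
    (hμ : μ ∈ stdSimplex ℝ Ω)
    (hcap : ∀ v, ∀ S ⊆ N.incE v,
      ∑ e ∈ S, ∑ ω, μ ω * ∑ i, (if e ∈ w ω i then lam * D i else 0) ≤ N.rho v S) :
    ∃ f : ι → List E → ℝ, N.IsFlow s t f ∧ ∀ i, rate f i = lam * D i := by
  let f : ι → List E → ℝ := fun i p => ∑ ω, if w ω i = p then μ ω * (lam * D i) else 0
  have hnn : ∀ ω i, 0 ≤ μ ω * (lam * D i) := fun ω i =>
    mul_nonneg (hμ.1 ω) (mul_nonneg hlam (hD i))
  have hsupp : ∀ i p, f i p ≠ 0 → ∃ ω, w ω i = p ∧ D i ≠ 0 := by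
    intro i p hp
    obtain ⟨ω, -, hω⟩ := exists_ne_zero_of_sum_ne_zero hp
    simp only [ne_eq, ite_eq_right_iff, not_forall] at hω
    exact ⟨ω, hω.1, fun h => hω.2 (by simp [h])⟩
  refine ⟨f, ⟨fun i p => sum_nonneg fun ω _ => ?_, ?_, ?_, ?_⟩, ?_⟩
  · split_ifs
    exacts [hnn ω i, le_rfl]
  · intro i p hp
    obtain ⟨ω, rfl, h⟩ := hsupp i p hp
    exact hw ω i ((hD i).lt_of_ne' h)
  · intro i
    refine (Set.finite_range fun ω => w ω i).subset fun p hp => ?_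
    obtain ⟨ω, rfl, -⟩ := hsupp i p hp
    exact ⟨ω, rfl⟩
  · intro v S hS
    refine le_of_eq_of_le (sum_congr rfl fun e _ => ?_) (hcap v S hS)
    simp only [edgeFlow, f, mul_sum]
    rw [sum_comm]
    refine sum_congr rfl fun i _ => (finsum_mem_sum_ite_eq {p | e ∈ p} _ _).trans ?_
    simp only [Set.mem_ofPred_eq, mul_ite, mul_zero]
  · intro i
    simp only [rate, f, finsum_sum_ite_eq]
    rw [← sum_mul, hμ.2, one_mul]

/-- Duality: if rates `lam * D` are not achievable, then there are portions `c v e` of edge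
lengths whose cost is less than `lam` times the total length of any routing of the demands.
The cost is witnessed by greedy vectors `x v` of the polymatroids. -/
theorem exists_dual_lengths {s t : ι → V} {D : ι → ℝ} (hD : ∀ i, 0 ≤ D i) {lam : ℝ}
    (hlam : 0 ≤ lam)
    (hno : ¬ ∃ f : ι → List E → ℝ, N.IsFlow s t f ∧ ∀ i, rate f i = lam * D i) :
    ∃ c x : V → E → ℝ, (∀ v e, 0 ≤ c v e) ∧ (∀ v, ∀ e ∉ N.incE v, c v e = 0) ∧
      (∀ v, ∀ θ : ℝ,
        ∑ e ∈ N.incE v with θ ≤ c v e, x v e = N.rho v {e ∈ N.incE v | θ ≤ c v e}) ∧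
      ∀ w : ι → List E, (∀ i, 0 < D i → UIsPath N.ep1 N.ep2 (s i) (t i) (w i)) →
        ∑ v, ∑ e ∈ N.incE v, x v e * c v e <
            lam * ∑ i, D i * ((w i).map fun e => ∑ v, c v e).sum ∧
          0 < lam * ∑ i, D i * ((w i).map fun e => ∑ v, c v e).sum := by
  let Q : ι → Set (List E) := fun i =>
    {p | UIsPath N.ep1 N.ep2 (s i) (t i) p ∨ D i = 0 ∧ p = []}
  have hQ : (Set.univ.pi Q).Finite := Set.Finite.pi fun i =>
    ((finite_setOf_uIsPath (s i) (t i)).union (Set.finite_singleton [])).subset fun p hp =>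
      hp.imp id And.right
  let Ω := Set.univ.pi Q
  have : Fintype Ω := hQ.fintype
  let pt : Ω → V × E → ℝ := fun ω ve => ∑ i, if ve.2 ∈ ω.1 i then lam * D i else 0
  let comb : (Ω → ℝ) →ₗ[ℝ] (V × E → ℝ) := Fintype.linearCombination ℝ pt
  let A : Set (V × E → ℝ) := comb '' stdSimplex ℝ Ω
  let B : Set (V × E → ℝ) :=
    {x | ∀ v, ∀ S ⊆ N.incE v, ∑ e ∈ S, x (v, e) ≤ N.rho v S}
  have hAc : IsCompact A :=
    (isCompact_stdSimplex ℝ Ω).image comb.continuous_of_finiteDimensional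
  have hAv : Convex ℝ A := (convex_stdSimplex ℝ Ω).linear_image comb
  have hBv : Convex ℝ B := by
    intro x hx y hy a b ha hb hab v S hS
    have h1 := mul_le_mul_of_nonneg_left (hx v S hS) ha
    have h2 := mul_le_mul_of_nonneg_left (hy v S hS) hb
    simp only [Pi.add_apply, Pi.smul_apply, smul_eq_mul, sum_add_distrib, ← mul_sum]
    calc _ ≤ a * N.rho v S + b * N.rho v S := add_le_add h1 h2
      _ = _ := by rw [← add_mul, hab, one_mul]
  have hBc : IsClosed B := by
    simp only [B, Set.ofPred_forall]
    exact isClosed_iInter fun v => isClosed_iInter fun S => isClosed_iInter fun _ =>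
      isClosed_le (by fun_prop) continuous_const
  have hdisj : Disjoint B A := by
    refine Set.disjoint_left.2 ?_
    rintro _ hB ⟨μ, hμ, rfl⟩
    refine hno (N.exists_isFlow_of_combination hD hlam (w := fun ω : Ω => ω.1) ?_ hμ ?_)
    · intro ω i hi
      exact (ω.2 i trivial).resolve_right fun h => hi.ne' h.1
    · intro v S hS
      simpa [comb, pt, Fintype.linearCombination_apply] using hB v S hS
  obtain ⟨φ, a, b, hφB, hab, hφA⟩ :=
    geometric_hahn_banach_closed_compact hBv hBc hAv hAc hdisj
  let c : V → E → ℝ := fun v e => φ (Pi.single (v, e) 1)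
  have hφ : ∀ x, φ x = ∑ v, ∑ e, x (v, e) * c v e := by
    intro x
    have := LinearMap.pi_apply_eq_sum_univ φ.toLinearMap x
    rw [← Fintype.sum_prod_type' (f := fun v e => x (v, e) * c v e)]
    refine this.trans (sum_congr rfl fun ve _ => ?_)
    simp only [smul_eq_mul, c]
    have h : (fun j => if ve = j then (1 : ℝ) else 0) = Pi.single ve 1 := by
      ext j
      simp [Pi.single_apply, eq_comm]
    rw [h]
    rfl
  have hsingle : ∀ v e (r : ℝ), φ (Pi.single (v, e) r) = r * c v e := by
    intro v e r
    rw [← smul_eq_mul, ← map_smul, ← Pi.single_smul, smul_eq_mul, mul_one]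
  have hmem : ∀ v e (r : ℝ), (e ∈ N.incE v → r ≤ 0) → Pi.single (v, e) r ∈ B := by
    intro v e r hr u S hS
    refine le_trans (sum_nonpos fun e' he' => ?_) (N.rho_nonneg u S hS)
    rw [Pi.single_apply]
    split_ifs with h
    · obtain ⟨rfl, rfl⟩ := Prod.mk.inj h
      exact hr (hS he')
    · exact le_rfl
  have ha0 : 0 < a := by
    simpa using hφB 0 fun v S hS => by simpa using N.rho_nonneg v S hS
  have hc : ∀ v e, 0 ≤ c v e := by
    intro v e
    by_contra! h
    have h1 := hφB _ (hmem v e (a / c v e) fun _ => (div_neg_of_pos_of_neg ha0 h).le)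
    rw [hsingle, div_mul_cancel₀ _ h.ne] at h1
    exact lt_irrefl _ h1
  have hc0 : ∀ v, ∀ e ∉ N.incE v, c v e = 0 := by
    intro v e he
    by_contra h
    have h1 := hφB _ (hmem v e (a / c v e) fun h => absurd h he)
    rw [hsingle, div_mul_cancel₀ _ h] at h1
    exact lt_irrefl _ h1
  choose x hxS hx using fun v => exists_greedy_vector (N.rho v) (N.incE v) (N.rho_empty v)
    (N.rho_submod v) (c v)
  refine ⟨c, x, hc, hc0, hx, fun w hw => ?_⟩
  have hxB := hφB (fun ve => x ve.1 ve.2) fun v S hS => hxS v S hS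
  rw [hφ] at hxB
  have hsub : ∀ v, ∑ e ∈ N.incE v, x v e * c v e = ∑ e, x v e * c v e := fun v =>
    sum_subset (subset_univ _) fun e _ he => by rw [hc0 v e he, mul_zero]
  let ω : Ω := ⟨fun i => if 0 < D i then w i else [], fun i _ => by
    dsimp only [Q]
    split_ifs with h
    · exact Or.inl (hw i h)
    · exact Or.inr ⟨le_antisymm (not_lt.1 h) (hD i), rfl⟩⟩
  have hptA : pt ω ∈ A :=
    ⟨Pi.single ω 1, single_mem_stdSimplex ℝ ω, by simp [comb, Fintype.linearCombination_apply_single]⟩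
  have hlen : φ (pt ω) ≤ lam * ∑ i, D i * ((w i).map fun e => ∑ v, c v e).sum := by
    have hle : ∀ p : List E, ∑ e ∈ p.toFinset, ∑ v, c v e ≤ (p.map fun e => ∑ v, c v e).sum := by
      intro p
      induction p with
      | nil => simp
      | cons e p ih =>
        have h0 : 0 ≤ ∑ v, c v e := sum_nonneg fun v _ => hc v e
        rw [List.toFinset_cons, List.map_cons, List.sum_cons]
        by_cases he : e ∈ p.toFinset
        · rw [insert_eq_of_mem he]; linarith
        · rw [sum_insert he]; linarith
    calc φ (pt ω) = ∑ i, lam * D i * ∑ e ∈ (ω.1 i).toFinset, ∑ v, c v e := by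
          have h1 : φ (pt ω) =
              ∑ e, (∑ i, if e ∈ ω.1 i then lam * D i else 0) * ∑ v, c v e := by
            rw [hφ, sum_comm]
            exact sum_congr rfl fun e _ => by rw [mul_sum]
          simp only [h1, sum_mul]
          rw [sum_comm]
          refine sum_congr rfl fun i _ => ?_
          rw [← sum_subset (subset_univ (ω.1 i).toFinset) fun e _ he => ?_, mul_sum]
          · exact sum_congr rfl fun e he => by rw [if_pos (List.mem_toFinset.1 he)]
          · rw [if_neg fun h => he (List.mem_toFinset.2 h), zero_mul]
      _ ≤ _ := by
          rw [mul_sum]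
          refine sum_le_sum fun i _ => ?_
          rw [← mul_assoc]
          rcases (hD i).eq_or_lt with h | h
          · simp [← h]
          · simp only [ω, if_pos h]
            exact mul_le_mul_of_nonneg_left (hle _) (mul_nonneg hlam h.le)
  have hb := hφA _ hptA
  simp only [hsub]
  constructor <;> linarith

end Duality

end UPolyNet

namespace UPolyNet

section Concurrent

variable {V E : Type} [Fintype V] [Fintype E] [DecidableEq V] [DecidableEq E]
  (N : UPolyNet V E) {ι : Type} [Fintype ι]

theorem IsFlow.rate_le {N : UPolyNet V E} {s t : ι → V} {f : ι → List E → ℝ}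
    (hf : N.IsFlow s t f) {i : ι} (hst : s i ≠ t i) :
    rate f i ≤ ∑ e, N.rho (N.ep1 e) {e} := by
  have hsupp : Function.support (f i) ⊆ ((hf.fin i).toFinset : Set (List E)) := by simp
  have hpath : ∀ e, ∑ᶠ p ∈ {p : List E | e ∈ p}, f i p =
      ∑ p ∈ (hf.fin i).toFinset, if e ∈ p then f i p else 0 := by
    intro e
    rw [finsum_mem_def, finsum_eq_sum_of_support_subset _
      ((Set.support_indicator.subset.trans Set.inter_subset_right).trans hsupp)]
    exact sum_congr rfl fun p _ => by simp [Set.indicator_apply]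
  calc rate f i = ∑ p ∈ (hf.fin i).toFinset, f i p :=
        finsum_eq_sum_of_support_subset _ hsupp
    _ ≤ ∑ p ∈ (hf.fin i).toFinset, ∑ e, if e ∈ p then f i p else 0 := by
        refine sum_le_sum fun p hp => ?_
        have hw := (hf.supp i p ((hf.fin i).mem_toFinset.1 hp)).1
        cases p with
        | nil => exact absurd hw hst
        | cons e p =>
          refine le_trans ?_ (single_le_sum (fun e' _ => ?_) (mem_univ e))
          · simp
          · split_ifs
            exacts [hf.nonneg _ _, le_rfl]
    _ = ∑ e, ∑ᶠ p ∈ {p : List E | e ∈ p}, f i p := by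
        rw [sum_comm]
        simp_rw [hpath]
    _ ≤ ∑ e, N.edgeFlow f e := sum_le_sum fun e _ =>
        single_le_sum (f := fun j => ∑ᶠ p ∈ {p : List E | e ∈ p}, f j p)
          (fun j _ => finsum_nonneg fun p => finsum_nonneg fun _ => hf.nonneg j p) (mem_univ i)
    _ ≤ _ := sum_le_sum fun e _ => by
        simpa using hf.cap (N.ep1 e) {e} (by simp [incE])

theorem bddAbove_concurrent {s t : ι → V} {D : ι → ℝ} {i : ι} (hst : s i ≠ t i)
    (hi : 0 < D i) :
    BddAbove { lam : ℝ | ∃ f : ι → List E → ℝ, N.IsFlow s t f ∧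
      ∀ i, rate f i = lam * D i } := by
  refine ⟨(∑ e, N.rho (N.ep1 e) {e}) / D i, ?_⟩
  rintro lam ⟨f, hf, hr⟩
  rw [le_div_iff₀ hi, ← hr i]
  exact hf.rate_le hst

theorem maxConcurrent_nonneg (s t : ι → V) (D : ι → ℝ) : 0 ≤ N.maxConcurrent s t D := by
  refine Real.sSup_nonneg' ⟨0, ⟨fun _ _ => 0, ⟨fun _ _ => le_rfl, ?_, ?_, ?_⟩, ?_⟩, le_rfl⟩
  · simp
  · simp [Function.support]
  · intro v S hS
    simpa [edgeFlow] using N.rho_nonneg v S hS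
  · simp [rate]

end Concurrent

section FlowCutGap

variable {V E : Type} [Fintype V] [Fintype E] [DecidableEq V] [DecidableEq E]
  (N : UPolyNet V E) {ι : Type} [Fintype ι]

theorem sum_portions_le {c : V → E → ℝ} (hc : ∀ v e, 0 ≤ c v e)
    (hc0 : ∀ v, ∀ e ∉ N.incE v, c v e = 0) (e : E) :
    ∑ v, c v e ≤ c (N.ep1 e) e + c (N.ep2 e) e := by
  rw [← sum_subset (subset_univ {N.ep1 e, N.ep2 e}) fun v _ hv => hc0 v e ?_]
  · by_cases h : N.ep1 e = N.ep2 e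
    · simpa [h] using hc (N.ep2 e) e
    · rw [sum_pair h]
  · simp only [mem_insert, mem_singleton, not_or] at hv
    simp only [incE, mem_filter, mem_univ, true_and, not_or]
    exact ⟨Ne.symm hv.1, Ne.symm hv.2⟩

/-- If no cut is sparser than `β` and rates `lam * D` are not achievable, then `β` exceeds
`lam` by at most a factor logarithmic in the number of terminals. -/
theorem sparsity_lt_of_not_exists_isFlow {s t : ι → V} {D : ι → ℝ} (hD : ∀ i, 0 ≤ D i)
    {β lam : ℝ} (hβ0 : 0 < β) (hlam : 0 ≤ lam)
    (hβ : ∀ F, β * N.sepDemand s t D F ≤ N.cutCost F)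
    (hno : ¬ ∃ f : ι → List E → ℝ, N.IsFlow s t f ∧ ∀ i, rate f i = lam * D i) :
    β < 48 * (Nat.log 2 #(univ.image s ∪ univ.image t) + 1 : ℕ) * lam := by
  set T := univ.image s ∪ univ.image t
  have hconn : ∀ i, 0 < D i → ∃ p, UWalk N.ep1 N.ep2 (s i) (t i) p := by
    intro i hi
    by_contra h
    have hsep : D i ≤ N.sepDemand s t D ∅ := by
      refine le_trans ?_ (single_le_sum (fun j _ => ?_) (mem_univ i))
      · rw [if_pos]
        rintro ⟨p, hp, -⟩
        exact h ⟨p, hp⟩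
      · split_ifs
        exacts [hD j, le_rfl]
    have h1 := hβ ∅
    rw [N.cutCost_empty] at h1
    linarith [mul_pos hβ0 (hi.trans_le hsep)]
  obtain ⟨c, x, hc, hc0, hx, hdual⟩ := N.exists_dual_lengths hD hlam hno
  obtain ⟨d, hself, hnn, hsymm, htri, hedge, hpath⟩ := exists_path_pseudometric N.ep1 N.ep2
    (len := fun e => ∑ v, c v e) fun e => sum_nonneg fun v _ => hc v e
  have hw : ∀ i, ∃ p, 0 < D i → UIsPath N.ep1 N.ep2 (s i) (t i) p ∧
      (p.map fun e => ∑ v, c v e).sum ≤ d (s i) (t i) := by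
    intro i
    by_cases hi : 0 < D i
    · obtain ⟨p, hp⟩ := hpath _ _ (hconn i hi)
      exact ⟨p, fun _ => hp⟩
    · exact ⟨[], fun h => absurd h hi⟩
  choose w hw using hw
  obtain ⟨hX, hpos⟩ := hdual w fun i hi => (hw i hi).1
  set X := ∑ v, ∑ e ∈ N.incE v, x v e * c v e
  have hlen : lam * ∑ i, D i * ((w i).map fun e => ∑ v, c v e).sum ≤
      lam * ∑ i, D i * d (s i) (t i) := by
    refine mul_le_mul_of_nonneg_left (sum_le_sum fun i _ => ?_) hlam
    rcases (hD i).eq_or_lt with h | h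
    · simp [← h]
    · exact mul_le_mul_of_nonneg_left (hw i h).2 h.le
  set S := ∑ i, D i * d (s i) (t i)
  have hS : 0 < S := pos_of_mul_pos_right (hpos.trans_le hlen) hlam
  set J := range (Nat.log 2 #T + 1) ×ˢ T.powerset
  let W : ℕ × Finset V → ℝ := fun jA => randomSubsetWeight T ((1 / 2) ^ (jA.1 + 1)) jA.2
  have hW : ∀ jA, 0 ≤ W jA := fun jA => randomSubsetWeight_nonneg T (by positivity)
    (pow_le_one₀ (by norm_num) (by norm_num)) _
  have hWsum : ∑ jA ∈ J, W jA = (Nat.log 2 #T + 1 : ℕ) := by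
    simp [J, W, sum_product, sum_randomSubsetWeight]
  have key : β * (S / 24) ≤ (Nat.log 2 #T + 1 : ℕ) * (2 * X) := by
    calc β * (S / 24) = β * ∑ i, D i * (d (s i) (t i) / 24) := by
          simp_rw [S, sum_div, mul_div_assoc]
      _ ≤ β * ∑ i, D i * ∑ jA ∈ J,
            W jA * |distToSet d jA.2 (s i) - distToSet d jA.2 (t i)| := by
          refine mul_le_mul_of_nonneg_left (sum_le_sum fun i _ =>
            mul_le_mul_of_nonneg_left ?_ (hD i)) hβ0.le
          exact dist_le_sum_abs_distToSet hself hnn hsymm htri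
            (mem_union_left _ (mem_image_of_mem s (mem_univ i)))
            (mem_union_right _ (mem_image_of_mem t (mem_univ i)))
      _ = ∑ jA ∈ J, W jA *
            (β * ∑ i, D i * |distToSet d jA.2 (s i) - distToSet d jA.2 (t i)|) := by
          simp_rw [mul_sum]
          rw [sum_comm]
          exact sum_congr rfl fun _ _ => sum_congr rfl fun _ _ => by ring
      _ ≤ ∑ jA ∈ J, W jA * (2 * X) :=
          sum_le_sum fun jA _ => mul_le_mul_of_nonneg_left
            (N.sum_demand_mul_abs_sub_le hD hβ0.le hβ hc hx fun e =>
              (abs_distToSet_sub_le hnn hsymm htri _ _ _).trans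
                ((hedge e).trans (N.sum_portions_le hc hc0 e))) (hW jA)
      _ = _ := by rw [← sum_mul, hWsum]
  have hL : (0 : ℝ) < (Nat.log 2 #T + 1 : ℕ) := by positivity
  have h2 : ((Nat.log 2 #T + 1 : ℕ) : ℝ) * (2 * X) < (Nat.log 2 #T + 1 : ℕ) * (2 * (lam * S)) :=
    mul_lt_mul_of_pos_left (by linarith) hL
  refine lt_of_mul_lt_mul_right ?_ hS.le
  linarith

end FlowCutGap

end UPolyNet

theorem natLog_terminals_le {k m : ℕ} (hk : 2 ≤ k) (hm : m ≤ k * 2) :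
    ((Nat.log 2 m + 1 : ℕ) : ℝ) ≤ 6 * Real.log k := by
  have h1 : Nat.log 2 m ≤ Nat.log 2 k + 1 := by
    rw [← Nat.log_mul_base one_lt_two (by omega)]
    exact Nat.log_mono_right hm
  have h2 : (1 : ℝ) ≤ (Nat.log 2 k : ℕ) := by
    exact_mod_cast Nat.log_pos one_lt_two hk
  have h3 : (Nat.log 2 k : ℝ) * Real.log 2 ≤ Real.log k := by
    rw [← Real.log_pow]
    exact Real.log_le_log (by positivity) (by exact_mod_cast Nat.pow_log_le_self 2 (by omega))
  have h4 := Real.log_two_gt_d9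
  have h5 : ((Nat.log 2 m + 1 : ℕ) : ℝ) ≤ Nat.log 2 k + 2 := by exact_mod_cast by omega
  nlinarith

/-- There is a universal constant `C` such that in every undirected
polymatroidal network, for any multicommodity flow instance with `k ≥ 2` source-sink
pairs and demands `D`, the minimum sparsity is at most `C·(log k)` times the value of
the maximum concurrent flow. -/
theorem sparsest_cut_gap_undirected :
    ∃ C : ℝ, 0 < C ∧
      ∀ (V E : Type) [Fintype V] [Fintype E] [DecidableEq V] [DecidableEq E]
        (N : UPolyNet V E) (k : ℕ) (s t : Fin k → V) (D : Fin k → ℝ),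
        2 ≤ k →
        (∀ i, s i ≠ t i) →
        (∀ i, 0 ≤ D i) → (∃ i, 0 < D i) →
        ∃ F : Finset E, 0 < N.sepDemand s t D F ∧
          N.cutCost F / N.sepDemand s t D F ≤
            C * Real.log k * N.maxConcurrent s t D := by
  refine ⟨288, by norm_num, ?_⟩
  intro V E _ _ _ _ N k s t D hk hst hD ⟨i₀, hi₀⟩
  by_contra! hcon
  have hk1 : 0 < Real.log k := Real.log_pos (by exact_mod_cast hk)
  have hev : ∀ᶠ lam in nhdsWithin (N.maxConcurrent s t D) (Set.Ioi (N.maxConcurrent s t D)),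
      ∀ F, 0 < N.sepDemand s t D F →
        288 * Real.log k * lam < N.cutCost F / N.sepDemand s t D F := by
    refine Filter.eventually_all.2 fun F => ?_
    by_cases h : 0 < N.sepDemand s t D F
    · have hc : Continuous fun lam : ℝ => 288 * Real.log k * lam := by fun_prop
      have := (hc.tendsto (N.maxConcurrent s t D)).eventually_lt_const (hcon F h)
      exact (this.filter_mono nhdsWithin_le_nhds).mono fun _ h _ => h
    · exact Filter.Eventually.of_forall fun _ h' => absurd h' h
  obtain ⟨lam, hlam, hlt⟩ := (hev.and self_mem_nhdsWithin).exists
  have hlam0 : 0 < lam := (N.maxConcurrent_nonneg s t D).trans_lt hlt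
  have hno : ¬ ∃ f : Fin k → List E → ℝ, N.IsFlow s t f ∧ ∀ i, rate f i = lam * D i :=
    fun h => not_lt.2 (le_csSup (N.bddAbove_concurrent (hst i₀) hi₀) h) hlt
  have hgap := N.sparsity_lt_of_not_exists_isFlow hD (β := 288 * Real.log k * lam)
    (by positivity) hlam0.le ?_ hno
  · have hcard : #(univ.image s ∪ univ.image t) ≤ k * 2 := by
      have h1 := card_union_le (univ.image s) (univ.image t)
      have h2 := card_image_le (s := univ) (f := s)
      have h3 := card_image_le (s := univ) (f := t)
      simp only [card_univ, Fintype.card_fin] at h2 h3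
      omega
    have hlog := mul_le_mul_of_nonneg_right (natLog_terminals_le hk hcard) hlam0.le
    linarith
  · intro F
    by_cases h : 0 < N.sepDemand s t D F
    · exact ((lt_div_iff₀ h).1 (hlam F h)).le
    · exact (mul_nonpos_of_nonneg_of_nonpos (by positivity) (not_lt.1 h)).trans
        (N.cutCost_nonneg F)
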